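/- arXiv:2411.15564 — 2 statements merged into one kernel-verified Lean document; each statement's English description precedes it below -/
import Mathlib

section
/- Let r ≥ 1, x₁ > x₂ > 0, and k ≥ 2 an integer. Define on the Weyl chamber 𝒲 = {(λ₁,λ₂) : λ₁ > λ₂ > 0} the function φ(λ₁,λ₂) = |f_r(x₁λ₁)f_r(x₂λ₂) − f_r(x₁λ₂)f_r(x₂λ₁)|^{2k}/(λ₁²−λ₂²)^{2k−2} · (λ₁λ₂)^{1+2r}, where f_r(s) = J_r(s)/s^r. Then ∫_𝒲 φ dλ < ∞. -/
open MeasureTheory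

/-- Bessel function of the first kind of natural order `r`, via its power series. -/
noncomputable def besselJ (r : ℕ) (s : ℝ) : ℝ :=
  ∑' l : ℕ, ((-1 : ℝ)) ^ l * (s / 2) ^ (2 * l + r) / ((l.factorial : ℝ) * ((r + l).factorial : ℝ))

/-- The entire function `∑ (-t)^l / (l! (r+l)!)`, which satisfies
`J_r(s) = (s/2)^r * besselClifford r (s²/4)`. -/
noncomputable def besselClifford (r : ℕ) (t : ℝ) : ℝ :=
  ∑' l : ℕ, (-t) ^ l / ((l.factorial : ℝ) * ((r + l).factorial : ℝ))

theorem summable_besselClifford (r : ℕ) (t : ℝ) :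
    Summable fun l : ℕ => (-t) ^ l / ((l.factorial : ℝ) * ((r + l).factorial : ℝ)) := by
  refine Summable.of_norm_bounded (Real.summable_pow_div_factorial |t|) fun l => ?_
  have h : (1 : ℝ) ≤ ((r + l).factorial : ℝ) := by exact_mod_cast Nat.factorial_pos (r + l)
  have h' : (0 : ℝ) < (l.factorial : ℝ) := by exact_mod_cast Nat.factorial_pos l
  rw [norm_div, norm_pow, norm_neg, Real.norm_eq_abs, Real.norm_of_nonneg (by positivity)]
  gcongr
  nlinarith

theorem hasDerivAt_besselClifford (r : ℕ) (t : ℝ) :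
    HasDerivAt (besselClifford r) (-besselClifford (r + 1) t) t := by
  set R : ℝ := |t| + 1 with hR
  set u : ℕ → ℝ := fun l => (l : ℝ) * R ^ (l - 1) / (l.factorial : ℝ) with hu_def
  have hu : Summable u := by
    rw [← summable_nat_add_iff 1]
    refine (Real.summable_pow_div_factorial R).congr fun l => ?_
    simp only [hu_def, Nat.factorial_succ, Nat.add_sub_cancel]
    push_cast
    field_simp
  have key := hasDerivAt_tsum_of_isPreconnected
    (g := fun (l : ℕ) (y : ℝ) => (-y) ^ l / ((l.factorial : ℝ) * ((r + l).factorial : ℝ)))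
    (g' := fun (l : ℕ) (y : ℝ) =>
      ((l : ℝ) * (-y) ^ (l - 1) * (-1)) / ((l.factorial : ℝ) * ((r + l).factorial : ℝ)))
    (t := Metric.ball 0 R) (y₀ := t) (y := t) hu Metric.isOpen_ball
    (convex_ball (0 : ℝ) R).isPreconnected
    (fun l y _ => (((hasDerivAt_id y).neg).pow l).div_const _) ?_ (by simp [hR])
    (summable_besselClifford r t) (by simp [hR])
  · refine key.congr_deriv ?_
    rw [tsum_eq_zero_add']
    · simp only [Nat.cast_zero, zero_mul, zero_div, zero_add, Nat.add_sub_cancel]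
      rw [besselClifford, ← tsum_neg]
      refine tsum_congr fun l => ?_
      rw [Nat.factorial_succ, show r + (l + 1) = r + 1 + l by ring]
      push_cast
      field_simp
    · refine (summable_besselClifford (r + 1) t).neg.congr fun l => ?_
      rw [Nat.factorial_succ, show r + (l + 1) = r + 1 + l by ring]
      simp only [Nat.add_sub_cancel]
      push_cast
      field_simp
  · intro l y hy
    have hy' : |y| ≤ R := by simpa using (Metric.mem_ball.1 hy).le
    have h : (1 : ℝ) ≤ ((r + l).factorial : ℝ) := by exact_mod_cast Nat.factorial_pos (r + l)
    have h' : (0 : ℝ) < (l.factorial : ℝ) := by exact_mod_cast Nat.factorial_pos l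
    rw [norm_div, norm_mul, norm_mul, norm_pow, norm_neg, norm_neg, norm_one, mul_one,
      Real.norm_eq_abs y, Real.norm_of_nonneg (by positivity : (0 : ℝ) ≤ l),
      Real.norm_of_nonneg (by positivity)]
    simp only [hu_def]
    gcongr
    nlinarith

theorem besselClifford_recurrence (r : ℕ) (t : ℝ) :
    t * besselClifford (r + 2) t - (r + 1) * besselClifford (r + 1) t + besselClifford r t = 0 := by
  have h1 := summable_besselClifford (r + 1) t
  have h0 := summable_besselClifford r t
  have h2 : t * besselClifford (r + 2) t
      = ∑' l : ℕ, -(l : ℝ) * ((-t) ^ l / ((l.factorial : ℝ) * ((r + 1 + l).factorial : ℝ))) := by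
    have hterm : ∀ l : ℕ, t * ((-t) ^ l / ((l.factorial : ℝ) * ((r + 2 + l).factorial : ℝ)))
        = -((l + 1 : ℕ) : ℝ) *
          ((-t) ^ (l + 1) / (((l + 1).factorial : ℝ) * ((r + 1 + (l + 1)).factorial : ℝ))) := by
      intro l
      rw [Nat.factorial_succ l, show r + 1 + (l + 1) = r + 2 + l by ring]
      push_cast
      field_simp
      ring
    rw [tsum_eq_zero_add', besselClifford, ← tsum_mul_left]
    · simp only [Nat.cast_zero, neg_zero, zero_mul, zero_add]
      exact tsum_congr hterm
    · exact ((summable_besselClifford (r + 2) t).mul_left t).congr hterm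
  have h3 : (r + 1) * besselClifford (r + 1) t - besselClifford r t
      = ∑' l : ℕ, -(l : ℝ) * ((-t) ^ l / ((l.factorial : ℝ) * ((r + 1 + l).factorial : ℝ))) := by
    rw [besselClifford, besselClifford, ← tsum_mul_left, ← (h1.mul_left _).tsum_sub h0]
    refine tsum_congr fun l => ?_
    rw [show r + 1 + l = (r + l) + 1 by ring, Nat.factorial_succ (r + l)]
    push_cast
    field_simp
    ring
  rw [h2, ← h3]
  ring

/-- The entire extension of `s ↦ J_r(s) / s^r`. -/
noncomputable def reducedBessel (r : ℕ) (s : ℝ) : ℝ :=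
  besselClifford r (s ^ 2 / 4) / 2 ^ r

theorem besselJ_div_pow (r : ℕ) {s : ℝ} (hs : s ≠ 0) :
    besselJ r s / s ^ r = reducedBessel r s := by
  rw [besselJ, reducedBessel, besselClifford, ← tsum_div_const, ← tsum_div_const]
  refine tsum_congr fun l => ?_
  rw [show -(s ^ 2 / 4) = (-1) * (s / 2) ^ 2 by ring, mul_pow, pow_add, pow_mul]
  field_simp
  rw [← mul_pow, div_mul_cancel₀ s two_ne_zero]

theorem hasDerivAt_reducedBessel (r : ℕ) (s : ℝ) :
    HasDerivAt (reducedBessel r) (-(s * reducedBessel (r + 1) s)) s := by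
  have h := ((hasDerivAt_besselClifford r (s ^ 2 / 4)).comp s
    ((hasDerivAt_pow 2 s).div_const 4)).div_const (2 ^ r)
  refine h.congr_deriv ?_
  rw [reducedBessel]
  push_cast
  field_simp
  ring

theorem continuous_reducedBessel (r : ℕ) : Continuous (reducedBessel r) :=
  continuous_iff_continuousAt.2 fun s => (hasDerivAt_reducedBessel r s).continuousAt

theorem reducedBessel_recurrence (r : ℕ) (s : ℝ) :
    s ^ 2 * reducedBessel (r + 2) s - 2 * (r + 1) * reducedBessel (r + 1) s
      + reducedBessel r s = 0 := by
  have h := besselClifford_recurrence r (s ^ 2 / 4)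
  have h' : s ^ 2 * reducedBessel (r + 2) s - 2 * (r + 1) * reducedBessel (r + 1) s
      + reducedBessel r s = (s ^ 2 / 4 * besselClifford (r + 2) (s ^ 2 / 4)
        - (r + 1) * besselClifford (r + 1) (s ^ 2 / 4) + besselClifford r (s ^ 2 / 4)) / 2 ^ r := by
    simp only [reducedBessel]
    field_simp
    ring
  rw [h', h, zero_div]

/-- The sum of the squares of `w(s) = √s J_r(s)` and of its derivative; `w` has second derivative
`((r² - 1/4)/s² - 1) w`. -/
noncomputable def besselEnergy (r : ℕ) (s : ℝ) : ℝ :=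
  s ^ (2 * r + 1) * (reducedBessel r s ^ 2
    + (s * reducedBessel (r + 1) s - (r + 1 / 2) * reducedBessel r s / s) ^ 2)

theorem hasDerivAt_besselEnergy (r : ℕ) {s : ℝ} (hs : s ≠ 0) :
    HasDerivAt (besselEnergy r)
      ((r ^ 2 - 1 / 4) / s ^ 2 * (besselEnergy r s - s ^ (2 * r + 1) * (reducedBessel r s
        + (s * reducedBessel (r + 1) s - (r + 1 / 2) * reducedBessel r s / s)) ^ 2)) s := by
  have hA := hasDerivAt_reducedBessel r s
  have hC := hasDerivAt_reducedBessel (r + 1) s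
  have hB := ((hasDerivAt_id s).mul hC).sub ((hA.const_mul (r + 1 / 2 : ℝ)).div (hasDerivAt_id s) hs)
  have h := (hasDerivAt_pow (2 * r + 1) s).mul ((hA.pow 2).add (hB.pow 2))
  refine h.congr_deriv ?_
  have hrec := reducedBessel_recurrence r s
  have hD : reducedBessel (r + 1 + 1) s
      = (2 * (r + 1) * reducedBessel (r + 1) s - reducedBessel r s) / s ^ 2 := by
    rw [eq_div_iff (pow_ne_zero 2 hs)]
    linear_combination hrec
  simp only [besselEnergy, hD, id, Pi.mul_apply, Pi.sub_apply, Pi.add_apply, Pi.pow_apply,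
    Pi.div_apply, Nat.add_sub_cancel]
  push_cast
  field_simp
  ring

theorem antitoneOn_besselEnergy_mul_exp {r : ℕ} (hr : 1 ≤ r) :
    AntitoneOn (fun s : ℝ => besselEnergy r s * Real.exp ((r ^ 2 - 1 / 4) / s)) (Set.Ici 1) := by
  set c : ℝ := (r : ℝ) ^ 2 - 1 / 4 with hc_def
  have hc : 0 ≤ c := by
    have : (1 : ℝ) ≤ r := by exact_mod_cast hr
    nlinarith
  have hderiv : ∀ s : ℝ, 0 < s → HasDerivAt (fun s => besselEnergy r s * Real.exp (c / s))
      (-(c / s ^ 2 * s ^ (2 * r + 1) * (reducedBessel r s + (s * reducedBessel (r + 1) s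
        - (r + 1 / 2) * reducedBessel r s / s)) ^ 2 * Real.exp (c / s))) s := by
    intro s hs
    have h := (hasDerivAt_besselEnergy r hs.ne').mul
      (((hasDerivAt_const s c).div (hasDerivAt_id s) hs.ne').exp)
    refine h.congr_deriv ?_
    simp only [Pi.div_apply, id]
    ring
  refine antitoneOn_of_deriv_nonpos (convex_Ici 1) ?_ ?_ ?_
  · exact fun s hs => (hderiv s (one_pos.trans_le hs)).continuousAt.continuousWithinAt
  · intro s hs
    rw [interior_Ici] at hs
    exact (hderiv s (one_pos.trans hs)).differentiableAt.differentiableWithinAt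
  · intro s hs
    rw [interior_Ici] at hs
    have hs0 : 0 < s := one_pos.trans hs
    rw [(hderiv s hs0).deriv]
    exact neg_nonpos.2 (by positivity)

theorem exists_reducedBessel_sq_le {r : ℕ} (hr : 1 ≤ r) :
    ∃ M : ℝ, 0 ≤ M ∧ ∀ s : ℝ, 0 ≤ s → (1 + s) ^ (2 * r + 1) * reducedBessel r s ^ 2 ≤ M := by
  have hcont : Continuous fun s : ℝ => (1 + s) ^ (2 * r + 1) * reducedBessel r s ^ 2 :=
    ((continuous_const.add continuous_id).pow _).mul ((continuous_reducedBessel r).pow 2)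
  obtain ⟨M₀, hM₀⟩ := (isCompact_Icc (a := (0 : ℝ)) (b := 1)).bddAbove_image hcont.continuousOn
  set c : ℝ := (r : ℝ) ^ 2 - 1 / 4 with hc_def
  have hc : 0 ≤ c := by
    have : (1 : ℝ) ≤ r := by exact_mod_cast hr
    nlinarith
  set M₁ : ℝ := 2 ^ (2 * r + 1) * (besselEnergy r 1 * Real.exp (c / 1)) with hM₁
  refine ⟨max 0 (max M₀ M₁), le_max_left _ _, fun s hs => ?_⟩
  rcases le_total s 1 with h1 | h1
  · exact (hM₀ ⟨s, ⟨hs, h1⟩, rfl⟩).trans ((le_max_left _ _).trans (le_max_right _ _))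
  · refine le_trans ?_ ((le_max_right _ _).trans (le_max_right _ _))
    have hanti := antitoneOn_besselEnergy_mul_exp hr (Set.mem_Ici.2 le_rfl) (Set.mem_Ici.2 h1) h1
    have hE : s ^ (2 * r + 1) * reducedBessel r s ^ 2 ≤ besselEnergy r s := by
      rw [besselEnergy]
      gcongr
      exact le_add_of_nonneg_right (sq_nonneg _)
    have hE0 : 0 ≤ besselEnergy r s := le_trans (by positivity) hE
    have hexp : 1 ≤ Real.exp (c / s) := Real.one_le_exp (by positivity)
    calc (1 + s) ^ (2 * r + 1) * reducedBessel r s ^ 2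
        ≤ (2 * s) ^ (2 * r + 1) * reducedBessel r s ^ 2 := by gcongr; linarith
      _ = 2 ^ (2 * r + 1) * (s ^ (2 * r + 1) * reducedBessel r s ^ 2) := by rw [mul_pow]; ring
      _ ≤ 2 ^ (2 * r + 1) * (besselEnergy r s * Real.exp (c / s)) := by
        gcongr 2 ^ (2 * r + 1) * ?_
        exact hE.trans (le_mul_of_one_le_right hE0 hexp)
      _ ≤ M₁ := by
        rw [hM₁]
        gcongr 2 ^ (2 * r + 1) * ?_

theorem exists_reducedBessel_mul_sq_le {r : ℕ} (hr : 1 ≤ r) {x : ℝ} (hx : 0 < x) :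
    ∃ M : ℝ, 0 ≤ M ∧ ∀ s : ℝ, 0 ≤ s → reducedBessel r (x * s) ^ 2 ≤ M / (1 + s) ^ (2 * r + 1) := by
  obtain ⟨M, hM, h⟩ := exists_reducedBessel_sq_le hr
  refine ⟨(1 + x⁻¹) ^ (2 * r + 1) * M, by positivity, fun s hs => ?_⟩
  rw [le_div_iff₀ (by positivity)]
  have hle : 1 + s ≤ (1 + x⁻¹) * (1 + x * s) := by
    have : x⁻¹ * (x * s) = s := by field_simp
    have : 0 < x⁻¹ := by positivity
    nlinarith [mul_nonneg hx.le hs]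
  calc reducedBessel r (x * s) ^ 2 * (1 + s) ^ (2 * r + 1)
      ≤ reducedBessel r (x * s) ^ 2 * ((1 + x⁻¹) * (1 + x * s)) ^ (2 * r + 1) := by gcongr
    _ = (1 + x⁻¹) ^ (2 * r + 1) * ((1 + x * s) ^ (2 * r + 1) * reducedBessel r (x * s) ^ 2) := by
      rw [mul_pow]; ring
    _ ≤ (1 + x⁻¹) ^ (2 * r + 1) * M := by
      gcongr
      exact h _ (by positivity)

theorem exists_reducedBessel_sub_sq_le (r : ℕ) {x : ℝ} (hx : 0 < x) :
    ∃ M : ℝ, 0 ≤ M ∧ ∀ u v : ℝ, 0 ≤ v → v ≤ u →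
      (reducedBessel r (x * u) - reducedBessel r (x * v)) ^ 2
        ≤ M * (u ^ 2 - v ^ 2) ^ 2 / (1 + v) ^ (2 * r + 3) := by
  obtain ⟨M, hM, h⟩ := exists_reducedBessel_mul_sq_le (Nat.le_add_left 1 r) hx
  refine ⟨x ^ 4 * M, by positivity, fun u v hv hvu => ?_⟩
  have hu : 0 ≤ u := hv.trans hvu
  set K : ℝ := M / (1 + v) ^ (2 * r + 3) with hK
  have hK0 : 0 ≤ K := by positivity
  have hmvt := (convex_Icc v u).norm_image_sub_le_of_norm_hasDerivWithin_le
    (f := fun s => reducedBessel r (x * s)) (C := x ^ 2 * u * √K)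
    (fun s _ => ((hasDerivAt_reducedBessel r (x * s)).comp s
      ((hasDerivAt_id s).const_mul x)).hasDerivWithinAt) ?_
    (Set.left_mem_Icc.2 hvu) (Set.right_mem_Icc.2 hvu)
  · rw [Real.norm_eq_abs, Real.norm_eq_abs, abs_of_nonneg (sub_nonneg.2 hvu)] at hmvt
    calc (reducedBessel r (x * u) - reducedBessel r (x * v)) ^ 2
        ≤ (x ^ 2 * u * √K * (u - v)) ^ 2 := sq_le_sq' (abs_le.1 hmvt).1 (abs_le.1 hmvt).2
      _ = x ^ 4 * K * (u * (u - v)) ^ 2 := by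
        rw [mul_pow, mul_pow, Real.sq_sqrt hK0]; ring
      _ ≤ x ^ 4 * K * (u ^ 2 - v ^ 2) ^ 2 := by
        have := mul_nonneg hu (sub_nonneg.2 hvu)
        gcongr
        nlinarith
      _ = x ^ 4 * M * (u ^ 2 - v ^ 2) ^ 2 / (1 + v) ^ (2 * r + 3) := by
        rw [hK]; ring
  · rintro s ⟨hvs, hsu⟩
    have hs : 0 ≤ s := hv.trans hvs
    have hf : |reducedBessel (r + 1) (x * s)| ≤ √K := by
      refine Real.abs_le_sqrt ((h s hs).trans ?_)
      rw [hK, show 2 * (r + 1) + 1 = 2 * r + 3 by ring]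
      gcongr
    rw [mul_one, norm_mul, norm_neg, norm_mul, Real.norm_eq_abs, Real.norm_eq_abs,
      Real.norm_eq_abs, abs_of_nonneg (by positivity), abs_of_pos hx]
    calc x * s * |reducedBessel (r + 1) (x * s)| * x ≤ x * u * √K * x := by gcongr
      _ = x ^ 2 * u * √K := by ring

/-- The alternating numerator `f_r(x₁u) f_r(x₂v) - f_r(x₁v) f_r(x₂u)`. -/
noncomputable def besselDet (r : ℕ) (x₁ x₂ u v : ℝ) : ℝ :=
  reducedBessel r (x₁ * u) * reducedBessel r (x₂ * v)
    - reducedBessel r (x₁ * v) * reducedBessel r (x₂ * u)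

theorem exists_besselDet_sq_le_decay {r : ℕ} (hr : 1 ≤ r) {x₁ x₂ : ℝ} (hx₁ : 0 < x₁)
    (hx₂ : 0 < x₂) :
    ∃ C : ℝ, 0 ≤ C ∧ ∀ u v : ℝ, 0 ≤ u → 0 ≤ v →
      besselDet r x₁ x₂ u v ^ 2 ≤ C * (1 / ((1 + u) * (1 + v)) ^ (2 * r + 1)) := by
  obtain ⟨M₁, hM₁, h₁⟩ := exists_reducedBessel_mul_sq_le hr hx₁
  obtain ⟨M₂, hM₂, h₂⟩ := exists_reducedBessel_mul_sq_le hr hx₂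
  refine ⟨4 * (M₁ * M₂), by positivity, fun u v hu hv => ?_⟩
  have ha := mul_le_mul (h₁ u hu) (h₂ v hv) (sq_nonneg _) (by positivity)
  have hb := mul_le_mul (h₁ v hv) (h₂ u hu) (sq_nonneg _) (by positivity)
  calc besselDet r x₁ x₂ u v ^ 2
      ≤ 2 * (reducedBessel r (x₁ * u) ^ 2 * reducedBessel r (x₂ * v) ^ 2
        + reducedBessel r (x₁ * v) ^ 2 * reducedBessel r (x₂ * u) ^ 2) := by
        rw [besselDet]
        nlinarith [sq_nonneg (reducedBessel r (x₁ * u) * reducedBessel r (x₂ * v)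
          + reducedBessel r (x₁ * v) * reducedBessel r (x₂ * u))]
    _ ≤ 2 * (M₁ / (1 + u) ^ (2 * r + 1) * (M₂ / (1 + v) ^ (2 * r + 1))
        + M₁ / (1 + v) ^ (2 * r + 1) * (M₂ / (1 + u) ^ (2 * r + 1))) := by gcongr
    _ = 4 * (M₁ * M₂) * (1 / ((1 + u) * (1 + v)) ^ (2 * r + 1)) := by
      rw [mul_pow]
      field_simp
      ring

theorem exists_besselDet_sq_le_diff {r : ℕ} (hr : 1 ≤ r) {x₁ x₂ : ℝ} (hx₁ : 0 < x₁)
    (hx₂ : 0 < x₂) :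
    ∃ C : ℝ, 0 ≤ C ∧ ∀ u v : ℝ, 0 ≤ v → v ≤ u →
      besselDet r x₁ x₂ u v ^ 2 ≤ C * ((u ^ 2 - v ^ 2) ^ 2 * (1 / (1 + v) ^ (4 * r + 4))) := by
  obtain ⟨M₁, hM₁, h₁⟩ := exists_reducedBessel_mul_sq_le hr hx₁
  obtain ⟨M₂, hM₂, h₂⟩ := exists_reducedBessel_mul_sq_le hr hx₂
  obtain ⟨L₁, hL₁, d₁⟩ := exists_reducedBessel_sub_sq_le r hx₁
  obtain ⟨L₂, hL₂, d₂⟩ := exists_reducedBessel_sub_sq_le r hx₂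
  refine ⟨2 * (L₁ * M₂ + M₁ * L₂), by positivity, fun u v hv hvu => ?_⟩
  have ha := mul_le_mul (d₁ u v hv hvu) (h₂ v hv) (sq_nonneg _) (by positivity)
  have hb := mul_le_mul (h₁ v hv) (d₂ u v hv hvu) (sq_nonneg _) (by positivity)
  have hsplit : besselDet r x₁ x₂ u v
      = (reducedBessel r (x₁ * u) - reducedBessel r (x₁ * v)) * reducedBessel r (x₂ * v)
        - reducedBessel r (x₁ * v) * (reducedBessel r (x₂ * u) - reducedBessel r (x₂ * v)) := by
    rw [besselDet]; ring
  calc besselDet r x₁ x₂ u v ^ 2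
      ≤ 2 * ((reducedBessel r (x₁ * u) - reducedBessel r (x₁ * v)) ^ 2
          * reducedBessel r (x₂ * v) ^ 2 + reducedBessel r (x₁ * v) ^ 2
          * (reducedBessel r (x₂ * u) - reducedBessel r (x₂ * v)) ^ 2) := by
        rw [hsplit]
        nlinarith [sq_nonneg ((reducedBessel r (x₁ * u) - reducedBessel r (x₁ * v))
          * reducedBessel r (x₂ * v)
          + reducedBessel r (x₁ * v) * (reducedBessel r (x₂ * u) - reducedBessel r (x₂ * v)))]
    _ ≤ 2 * (L₁ * (u ^ 2 - v ^ 2) ^ 2 / (1 + v) ^ (2 * r + 3) * (M₂ / (1 + v) ^ (2 * r + 1))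
        + M₁ / (1 + v) ^ (2 * r + 1)
          * (L₂ * (u ^ 2 - v ^ 2) ^ 2 / (1 + v) ^ (2 * r + 3))) := by gcongr
    _ = 2 * (L₁ * M₂ + M₁ * L₂) * ((u ^ 2 - v ^ 2) ^ 2 * (1 / (1 + v) ^ (4 * r + 4))) := by
      rw [show 4 * r + 4 = (2 * r + 3) + (2 * r + 1) by ring, pow_add _ (2 * r + 3)]
      field_simp

theorem exists_besselDet_integrand_le {r : ℕ} (hr : 1 ≤ r) {x₁ x₂ : ℝ} (hx₁ : 0 < x₁)
    (hx₂ : 0 < x₂) {k : ℕ} (hk : 2 ≤ k) :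
    ∃ C : ℝ, ∀ u v : ℝ, 0 < v → v < u →
      |besselDet r x₁ x₂ u v| ^ (2 * k) / (u ^ 2 - v ^ 2) ^ (2 * k - 2) * (u * v) ^ (1 + 2 * r)
        ≤ C * ((1 + u ^ 2)⁻¹ * (1 + v ^ 2)⁻¹) := by
  obtain ⟨C₁, hC₁, h₁⟩ := exists_besselDet_sq_le_decay hr hx₁ hx₂
  obtain ⟨C₂, hC₂, h₂⟩ := exists_besselDet_sq_le_diff hr hx₁ hx₂
  refine ⟨C₁ ^ k + 8 * C₂ ^ k, fun u v hv hvu => ?_⟩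
  have hu : 0 < u := hv.trans hvu
  have hP : 0 < u ^ 2 - v ^ 2 := by nlinarith
  rw [pow_mul, sq_abs]
  have hsplit : ∀ a b c : ℝ, 0 ≤ a → 0 ≤ b →
      (c ≤ a * ((1 + u ^ 2)⁻¹ * (1 + v ^ 2)⁻¹) ∨ c ≤ b * ((1 + u ^ 2)⁻¹ * (1 + v ^ 2)⁻¹)) →
      c ≤ (a + b) * ((1 + u ^ 2)⁻¹ * (1 + v ^ 2)⁻¹) := by
    intro a b c ha hb h
    have hw : 0 ≤ (1 + u ^ 2)⁻¹ * (1 + v ^ 2)⁻¹ := by positivity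
    rcases h with h | h <;> nlinarith
  refine hsplit _ _ _ (by positivity) (by positivity) ?_
  rcases le_total 1 (u - v) with hfar | hnear
  · left
    have hP1 : 1 ≤ u ^ 2 - v ^ 2 := by nlinarith
    set Q : ℝ := (1 + u) * (1 + v) with hQ
    have hQ1 : 1 ≤ Q := by nlinarith [mul_pos hu hv]
    set q : ℝ := 1 / Q ^ (2 * r + 1) with hq
    have hq0 : 0 ≤ q := by positivity
    have hq1 : q ≤ 1 := div_le_one_of_le₀ (one_le_pow₀ hQ1) (by positivity)
    calc (besselDet r x₁ x₂ u v ^ 2) ^ k / (u ^ 2 - v ^ 2) ^ (2 * k - 2) * (u * v) ^ (1 + 2 * r)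
        ≤ (C₁ * q) ^ k / 1 * Q ^ (1 + 2 * r) := by
          gcongr
          · exact h₁ u v hu.le hv.le
          · exact one_le_pow₀ hP1
          · nlinarith
      _ ≤ C₁ ^ k * q ^ 2 * Q ^ (1 + 2 * r) := by
          rw [div_one, mul_pow]
          gcongr ?_ * ?_ * _
          exact pow_le_pow_of_le_one hq0 hq1 hk
      _ = C₁ ^ k * (1 / Q ^ (2 * r + 1)) := by
          rw [hq, show 1 + 2 * r = 2 * r + 1 by ring]
          field_simp
      _ ≤ C₁ ^ k * (1 / Q ^ 2) := by
          gcongr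
          omega
      _ ≤ C₁ ^ k * (1 / ((1 + u ^ 2) * (1 + v ^ 2))) := by
          gcongr
          rw [hQ, mul_pow]
          gcongr <;> nlinarith
      _ = C₁ ^ k * ((1 + u ^ 2)⁻¹ * (1 + v ^ 2)⁻¹) := by
          rw [one_div, mul_inv]
  · right
    set p : ℝ := 1 / (1 + v) ^ (4 * r + 4) with hp
    have hv1 : 1 ≤ 1 + v := by linarith
    have hp0 : 0 ≤ p := by positivity
    have hp1 : p ≤ 1 := div_le_one_of_le₀ (one_le_pow₀ hv1) (by positivity)
    obtain ⟨m, rfl⟩ : ∃ m, k = m + 2 := ⟨k - 2, by omega⟩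
    calc (besselDet r x₁ x₂ u v ^ 2) ^ (m + 2) / (u ^ 2 - v ^ 2) ^ (2 * (m + 2) - 2)
          * (u * v) ^ (1 + 2 * r)
        ≤ (C₂ * ((u ^ 2 - v ^ 2) ^ 2 * p)) ^ (m + 2) / (u ^ 2 - v ^ 2) ^ (2 * (m + 2) - 2)
          * ((1 + v) * (1 + v)) ^ (1 + 2 * r) := by
          gcongr
          · exact h₂ u v hv.le hvu.le
          · linarith
          · linarith
      _ = C₂ ^ (m + 2) * ((u ^ 2 - v ^ 2) ^ 2 * p ^ (m + 2)) * (1 + v) ^ (4 * r + 2) := by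
          rw [show 2 * (m + 2) - 2 = 2 * m + 2 by omega, ← sq, ← pow_mul,
            show 2 * (1 + 2 * r) = 4 * r + 2 by ring]
          congr 1
          generalize u ^ 2 - v ^ 2 = P at hP
          rw [mul_pow, mul_pow, ← pow_mul, show 2 * (m + 2) = 2 + (2 * m + 2) by ring, pow_add P 2]
          field_simp
      _ ≤ C₂ ^ (m + 2) * ((2 * (1 + v)) ^ 2 * p ^ 2) * (1 + v) ^ (4 * r + 2) := by
          gcongr ?_ * (?_ ^ 2 * ?_) * _
          · nlinarith
          · exact pow_le_pow_of_le_one hp0 hp1 hk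
      _ = 4 * C₂ ^ (m + 2) * (1 / (1 + v) ^ (4 * r + 4)) := by
          rw [hp]
          field_simp
          ring
      _ ≤ 4 * C₂ ^ (m + 2) * (1 / (1 + v) ^ 4) := by
          gcongr
          omega
      _ ≤ 4 * C₂ ^ (m + 2) * (1 / ((1 + u ^ 2) / 2 * (1 + v ^ 2))) := by
          gcongr
          rw [show (1 + v) ^ 4 = (1 + v) ^ 2 * (1 + v) ^ 2 by ring]
          gcongr <;> nlinarith
      _ = 8 * C₂ ^ (m + 2) * ((1 + u ^ 2)⁻¹ * (1 + v ^ 2)⁻¹) := by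
          field_simp
          ring

/-- Rank 2 regular case: for `r ≥ 1`, `x₁ > x₂ > 0` and integer `k ≥ 2`, the Plancherel
test integral over the Weyl chamber `{λ₁ > λ₂ > 0}` is finite, where `f_r(s) = J_r(s)/s^r`. -/
theorem stmt_10 (r : ℕ) (hr : 1 ≤ r) (x₁ x₂ : ℝ) (hx₂ : 0 < x₂) (hx : x₂ < x₁)
    (k : ℕ) (hk : 2 ≤ k) :
    ∫⁻ p in {p : ℝ × ℝ | 0 < p.2 ∧ p.2 < p.1},
      ENNReal.ofReal
        (|(besselJ r (x₁ * p.1) / (x₁ * p.1) ^ r) * (besselJ r (x₂ * p.2) / (x₂ * p.2) ^ r)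
            - (besselJ r (x₁ * p.2) / (x₁ * p.2) ^ r) * (besselJ r (x₂ * p.1) / (x₂ * p.1) ^ r)|
              ^ (2 * k)
          / (p.1 ^ 2 - p.2 ^ 2) ^ (2 * k - 2) * (p.1 * p.2) ^ (1 + 2 * r)) < ⊤ := by
  have hx₁ : 0 < x₁ := hx₂.trans hx
  obtain ⟨C, hC⟩ := exists_besselDet_integrand_le hr hx₁ hx₂ hk
  have hint : Integrable (fun p : ℝ × ℝ => C * ((1 + p.1 ^ 2)⁻¹ * (1 + p.2 ^ 2)⁻¹)) :=
    (integrable_inv_one_add_sq.mul_prod integrable_inv_one_add_sq).const_mul C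
  have hmeas : MeasurableSet {p : ℝ × ℝ | 0 < p.2 ∧ p.2 < p.1} :=
    (measurableSet_lt measurable_const measurable_snd).inter
      (measurableSet_lt measurable_snd measurable_fst)
  refine lt_of_le_of_lt (setLIntegral_mono' hmeas fun p hp => ?_)
    (hint.integrableOn (s := {p : ℝ × ℝ | 0 < p.2 ∧ p.2 < p.1})).lintegral_lt_top
  obtain ⟨hv, hvu⟩ := hp
  have hu : 0 < p.1 := hv.trans hvu
  rw [besselJ_div_pow r (mul_pos hx₁ hu).ne', besselJ_div_pow r (mul_pos hx₂ hv).ne',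
    besselJ_div_pow r (mul_pos hx₁ hv).ne', besselJ_div_pow r (mul_pos hx₂ hu).ne']
  exact ENNReal.ofReal_le_ofReal (hC p.1 p.2 hv hvu)
end

section
/- Let r ≥ 1, x > 0, and an integer k ≥ 2. Define on 𝒲 = {(λ₁,λ₂) : λ₁ > λ₂ > 0} the function φ(λ₁,λ₂) = |f_r(xλ₁) − f_r(xλ₂)|^{2k}/(λ₁²−λ₂²)^{2k−2} · (λ₁λ₂)^{1+2r}. Then ∫_𝒲 φ dλ < ∞ if and only if k ≥ 7/4 + r/2. -/
open MeasureTheory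

/-- The entire extension of `f_r(s) = J_r(s)/s^r`, via its power series. -/
noncomputable def fr (r : ℕ) (s : ℝ) : ℝ :=
  ∑' l : ℕ, ((-1 : ℝ)) ^ l * s ^ (2 * l) /
    ((2 : ℝ) ^ (2 * l + r) * (l.factorial : ℝ) * ((r + l).factorial : ℝ))

/-- The function `g_r` with `f_r(s) = g_r(s²)`, as a power series in `t = s²`. -/
noncomputable def frSq (r : ℕ) (t : ℝ) : ℝ :=
  ∑' l : ℕ, ((-1 : ℝ)) ^ l /
    ((2 : ℝ) ^ (2 * l + r) * (l.factorial : ℝ) * ((r + l).factorial : ℝ)) * t ^ l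

theorem fr_eq_frSq (r : ℕ) (s : ℝ) : fr r s = frSq r (s ^ 2) := by
  unfold fr frSq
  refine tsum_congr fun l => ?_
  rw [pow_mul]
  ring

theorem abs_frSq_coeff_le (r l : ℕ) :
    |((-1 : ℝ)) ^ l / ((2 : ℝ) ^ (2 * l + r) * (l.factorial : ℝ) * ((r + l).factorial : ℝ))|
      ≤ 1 / (l.factorial : ℝ) := by
  rw [abs_div, abs_pow, abs_neg, abs_one, one_pow, abs_of_pos (by positivity)]
  have h1 : (1 : ℝ) ≤ 2 ^ (2 * l + r) := one_le_pow₀ (by norm_num)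
  have h2 : (1 : ℝ) ≤ ((r + l).factorial : ℝ) := by exact_mod_cast Nat.factorial_pos _
  have h3 : (0 : ℝ) < (l.factorial : ℝ) := by exact_mod_cast Nat.factorial_pos _
  gcongr
  calc (l.factorial : ℝ) = 1 * l.factorial * 1 := by ring
    _ ≤ _ := by gcongr

theorem summable_frSq (r : ℕ) (t : ℝ) :
    Summable fun l : ℕ => ((-1 : ℝ)) ^ l /
      ((2 : ℝ) ^ (2 * l + r) * (l.factorial : ℝ) * ((r + l).factorial : ℝ)) * t ^ l := by
  refine Summable.of_norm_bounded (Real.summable_pow_div_factorial |t|) fun l => ?_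
  rw [Real.norm_eq_abs, abs_mul, abs_pow]
  calc _ ≤ 1 / (l.factorial : ℝ) * |t| ^ l := by
        gcongr
        exact abs_frSq_coeff_le r l
    _ = _ := by ring

theorem hasDerivAt_frSq (r : ℕ) (t : ℝ) : HasDerivAt (frSq r) (-frSq (r + 1) t / 2) t := by
  set c : ℕ → ℝ := fun l => ((-1 : ℝ)) ^ l /
    ((2 : ℝ) ^ (2 * l + r) * (l.factorial : ℝ) * ((r + l).factorial : ℝ)) with hc
  set R : ℝ := |t| + 1 with hR
  have hR1 : 1 ≤ R := by rw [hR]; linarith [abs_nonneg t]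
  have hbound : ∀ (l : ℕ) (y : ℝ), y ∈ Metric.ball (0 : ℝ) R →
      ‖c l * (l * y ^ (l - 1))‖ ≤ (2 * R) ^ l / (l.factorial : ℝ) := by
    intro l y hy
    rw [mem_ball_zero_iff, Real.norm_eq_abs] at hy
    rw [Real.norm_eq_abs, abs_mul, abs_mul, abs_pow, Nat.abs_cast, mul_pow]
    have h1 : |y| ^ (l - 1) ≤ R ^ l :=
      (pow_le_pow_left₀ (abs_nonneg y) hy.le _).trans (pow_le_pow_right₀ hR1 (Nat.sub_le _ _))
    have h2 : (l : ℝ) ≤ 2 ^ l := by exact_mod_cast l.lt_two_pow_self.le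
    calc |c l| * (l * |y| ^ (l - 1)) ≤ 1 / (l.factorial : ℝ) * (2 ^ l * R ^ l) := by
          gcongr
          exact abs_frSq_coeff_le r l
      _ = _ := by ring
  have hderiv : ∀ (l : ℕ) (y : ℝ), y ∈ Metric.ball (0 : ℝ) R →
      HasDerivAt (fun z => c l * z ^ l) (c l * (l * y ^ (l - 1))) y := fun l y _ =>
    (hasDerivAt_pow l y).const_mul (c l)
  have ht : t ∈ Metric.ball (0 : ℝ) R := by
    rw [mem_ball_zero_iff, Real.norm_eq_abs, hR]
    linarith
  have hsum := Real.summable_pow_div_factorial (2 * R)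
  have key := hasDerivAt_tsum_of_isPreconnected hsum Metric.isOpen_ball
    (convex_ball (0 : ℝ) R).isPreconnected hderiv hbound ht (summable_frSq r t) ht
  have hval : ∑' l : ℕ, c l * (l * t ^ (l - 1)) = -frSq (r + 1) t / 2 := by
    rw [(Summable.of_norm_bounded hsum fun l => hbound l t ht).tsum_eq_zero_add]
    simp only [Nat.cast_zero, zero_mul, mul_zero, zero_add]
    rw [frSq, ← tsum_neg, ← tsum_div_const]
    refine tsum_congr fun l => ?_
    simp only [hc, Nat.add_sub_cancel, Nat.factorial_succ]
    rw [show r + (l + 1) = r + 1 + l by ring, show 2 * (l + 1) + r = 2 * l + (r + 1) + 1 by ring]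
    push_cast
    have h3 : (l.factorial : ℝ) ≠ 0 := by exact_mod_cast Nat.factorial_ne_zero _
    have h4 : ((r + 1 + l).factorial : ℝ) ≠ 0 := by exact_mod_cast Nat.factorial_ne_zero _
    have h5 : (l : ℝ) + 1 ≠ 0 := by positivity
    field_simp
    ring
  rw [hval] at key
  exact key

theorem continuous_fr (r : ℕ) : Continuous (fr r) := by
  have h : Continuous (frSq r) :=
    continuous_iff_continuousAt.2 fun t => (hasDerivAt_frSq r t).continuousAt
  rw [funext (fr_eq_frSq r)]
  fun_prop

/-- The three-term recurrence of the Bessel functions. -/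
theorem mul_frSq_add_two (r : ℕ) (t : ℝ) :
    t * frSq (r + 2) t = 2 * (r + 1) * frSq (r + 1) t - frSq r t := by
  have h : 2 * ((r : ℝ) + 1) * frSq (r + 1) t - frSq r t =
      ∑' l : ℕ, (2 * ((r : ℝ) + 1) * (((-1 : ℝ)) ^ l /
        ((2 : ℝ) ^ (2 * l + (r + 1)) * (l.factorial : ℝ) * ((r + 1 + l).factorial : ℝ)) * t ^ l)
        - ((-1 : ℝ)) ^ l /
        ((2 : ℝ) ^ (2 * l + r) * (l.factorial : ℝ) * ((r + l).factorial : ℝ)) * t ^ l) := by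
    rw [((summable_frSq (r + 1) t).mul_left _).tsum_sub (summable_frSq r t), tsum_mul_left]
    rfl
  rw [h, (((summable_frSq (r + 1) t).mul_left _).sub (summable_frSq r t)).tsum_eq_zero_add,
    frSq, ← tsum_mul_left]
  have h0 : ((r.factorial : ℕ) : ℝ) ≠ 0 := by exact_mod_cast Nat.factorial_ne_zero _
  have h1 : (r : ℝ) + 1 ≠ 0 := by positivity
  have hz : 2 * ((r : ℝ) + 1) * (((-1 : ℝ)) ^ 0 /
        ((2 : ℝ) ^ (2 * 0 + (r + 1)) * (Nat.factorial 0 : ℝ) * ((r + 1 + 0).factorial : ℝ)) * t ^ 0)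
        - ((-1 : ℝ)) ^ 0 /
        ((2 : ℝ) ^ (2 * 0 + r) * (Nat.factorial 0 : ℝ) * ((r + 0).factorial : ℝ)) * t ^ 0 = 0 := by
    simp only [add_zero, Nat.factorial_succ, mul_zero, zero_add]
    push_cast
    simp only [Nat.factorial_zero]
    field_simp
    ring
  rw [hz, zero_add]
  refine tsum_congr fun l => ?_
  rw [show r + 1 + (l + 1) = r + 2 + l by ring, show r + (l + 1) = r + 1 + l by ring,
    show r + 2 + l = (r + 1 + l) + 1 by ring]
  simp only [Nat.factorial_succ]
  push_cast
  have h3 : (l.factorial : ℝ) ≠ 0 := by exact_mod_cast Nat.factorial_ne_zero _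
  have h4 : ((r + 1 + l).factorial : ℝ) ≠ 0 := by exact_mod_cast Nat.factorial_ne_zero _
  have h5 : (l : ℝ) + 1 ≠ 0 := by positivity
  have h6 : (r : ℝ) + 1 + l + 1 ≠ 0 := by positivity
  field_simp
  ring

theorem frSq_energy_le_one {t : ℝ} (ht : 0 ≤ t) : frSq 0 t ^ 2 + t * frSq 1 t ^ 2 ≤ 1 := by
  have hd : ∀ y, HasDerivAt (fun y => frSq 0 y ^ 2 + y * frSq 1 y ^ 2) (-frSq 1 y ^ 2) y := by
    intro y
    have h := ((hasDerivAt_frSq 0 y).pow 2).add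
      ((hasDerivAt_id y).mul ((hasDerivAt_frSq 1 y).pow 2))
    refine h.congr_deriv ?_
    have hrec := mul_frSq_add_two 0 y
    norm_num at hrec ⊢
    linear_combination (-frSq 1 y) * hrec
  have hanti : Antitone fun y => frSq 0 y ^ 2 + y * frSq 1 y ^ 2 :=
    antitone_of_hasDerivAt_nonpos hd fun y => by
      have := sq_nonneg (frSq 1 y)
      simp only [Pi.zero_apply]
      linarith
  have h0 : frSq 0 0 = 1 := by
    rw [frSq, tsum_eq_single 0 fun l hl => by simp [hl]]
    simp
  have := hanti ht
  simpa [h0] using this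

/-- Boundedness of the Bessel function `J_r(s) = s^r f_r(s)` on `[1, ∞)`. -/
theorem exists_abs_fr_mul_pow_le (r : ℕ) :
    ∃ C : ℝ, ∀ s : ℝ, 1 ≤ s → |fr r s| * s ^ r ≤ C := by
  induction r using Nat.twoStepInduction with
  | zero =>
    refine ⟨1, fun s hs => ?_⟩
    have h := frSq_energy_le_one (sq_nonneg s)
    rw [fr_eq_frSq, pow_zero, mul_one, ← sq_le_one_iff_abs_le_one]
    nlinarith [mul_nonneg (sq_nonneg s) (sq_nonneg (frSq 1 (s ^ 2)))]
  | one =>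
    refine ⟨1, fun s hs => ?_⟩
    have h := frSq_energy_le_one (sq_nonneg s)
    rw [fr_eq_frSq, pow_one, ← abs_of_nonneg (zero_le_one.trans hs), ← abs_mul,
      ← sq_le_one_iff_abs_le_one, abs_of_nonneg (zero_le_one.trans hs)]
    nlinarith [sq_nonneg (frSq 0 (s ^ 2))]
  | more r h0 h1 =>
    obtain ⟨A, hA⟩ := h0
    obtain ⟨B, hB⟩ := h1
    refine ⟨2 * (r + 1) * B + A, fun s hs => ?_⟩
    have hs0 : 0 ≤ s := zero_le_one.trans hs
    have hrec : s ^ 2 * fr (r + 2) s = 2 * (r + 1) * fr (r + 1) s - fr r s := by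
      simp only [fr_eq_frSq]
      exact mul_frSq_add_two r _
    have hle : s ^ r ≤ s ^ (r + 1) := pow_le_pow_right₀ hs (Nat.le_succ r)
    calc |fr (r + 2) s| * s ^ (r + 2) = |s ^ 2 * fr (r + 2) s| * s ^ r := by
          rw [abs_mul, abs_of_nonneg (sq_nonneg s)]
          ring
      _ ≤ (2 * (r + 1) * |fr (r + 1) s| + |fr r s|) * s ^ r := by
          rw [hrec]
          gcongr
          refine (abs_sub _ _).trans ?_
          rw [abs_mul, abs_of_nonneg (by positivity : (0 : ℝ) ≤ 2 * (r + 1))]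
      _ = 2 * (r + 1) * (|fr (r + 1) s| * s ^ r) + |fr r s| * s ^ r := by ring
      _ ≤ 2 * (r + 1) * (|fr (r + 1) s| * s ^ (r + 1)) + |fr r s| * s ^ r := by gcongr
      _ ≤ _ := by
          gcongr
          · exact hB s hs
          · exact hA s hs

theorem exists_abs_fr_le (r : ℕ) :
    ∃ C : ℝ, 0 ≤ C ∧ ∀ s : ℝ, 0 ≤ s → |fr r s| ≤ C / (1 + s) ^ r := by
  obtain ⟨A, hA⟩ := exists_abs_fr_mul_pow_le r
  obtain ⟨B, hB⟩ := (isCompact_Icc (a := (0 : ℝ)) (b := 1)).exists_bound_of_continuousOn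
    (continuous_fr r).continuousOn
  have hA0 : 0 ≤ A := le_trans (by positivity) (hA 1 le_rfl)
  have hB0 : 0 ≤ B := (norm_nonneg _).trans (hB 0 (by simp))
  refine ⟨(A + B) * 2 ^ r, by positivity, fun s hs => ?_⟩
  rw [le_div_iff₀ (by positivity)]
  rcases le_total s 1 with h | h
  · have hfs := hB s ⟨hs, h⟩
    rw [Real.norm_eq_abs] at hfs
    have h2 : 1 + s ≤ 2 := by linarith
    have h3 : |fr r s| ≤ A + B := by linarith
    gcongr
  · calc |fr r s| * (1 + s) ^ r ≤ |fr r s| * (2 * s) ^ r := by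
          gcongr
          linarith
      _ = (|fr r s| * s ^ r) * 2 ^ r := by rw [mul_pow]; ring
      _ ≤ (A + B) * 2 ^ r := by
          gcongr
          linarith [hA s h]

theorem exists_abs_fr_mul_le (r : ℕ) {x : ℝ} (hx : 0 < x) :
    ∃ C : ℝ, 0 ≤ C ∧ ∀ s : ℝ, 0 ≤ s → |fr r (x * s)| ≤ C / (1 + s) ^ r := by
  obtain ⟨C, hC0, hC⟩ := exists_abs_fr_le r
  refine ⟨C * (1 + 1 / x) ^ r, by positivity, fun s hs => ?_⟩
  refine (hC (x * s) (by positivity)).trans ?_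
  rw [div_le_div_iff₀ (by positivity) (by positivity), mul_assoc, ← mul_pow]
  gcongr
  have : (1 + 1 / x) * (1 + x * s) = 1 + s + x * s + 1 / x := by
    field_simp
    ring
  rw [this]
  have : 0 ≤ x * s + 1 / x := by positivity
  linarith

theorem exists_abs_fr_sub_le (r : ℕ) {x : ℝ} (hx : 0 < x) :
    ∃ C : ℝ, 0 ≤ C ∧ ∀ a b : ℝ, 0 ≤ a → a < b →
      |fr r (x * b) - fr r (x * a)| ≤ C / (1 + a) ^ r ∧
      |fr r (x * b) - fr r (x * a)| ≤ C * (b ^ 2 - a ^ 2) / (1 + a) ^ (r + 1) := by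
  obtain ⟨A, hA0, hA⟩ := exists_abs_fr_mul_le r hx
  obtain ⟨B, hB0, hB⟩ := exists_abs_fr_mul_le (r + 1) hx
  refine ⟨2 * A + x ^ 2 * B, by positivity, fun a b ha hab => ⟨?_, ?_⟩⟩
  · calc |fr r (x * b) - fr r (x * a)| ≤ |fr r (x * b)| + |fr r (x * a)| := abs_sub _ _
      _ ≤ A / (1 + b) ^ r + A / (1 + a) ^ r := add_le_add (hA b (ha.trans hab.le)) (hA a ha)
      _ ≤ A / (1 + a) ^ r + A / (1 + a) ^ r := by gcongr
      _ = (2 * A) / (1 + a) ^ r := by ring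
      _ ≤ _ := by
          gcongr
          have : 0 ≤ x ^ 2 * B := by positivity
          linarith
  · have hd : ∀ t, HasDerivAt (fun t => frSq r (x ^ 2 * t))
        (-frSq (r + 1) (x ^ 2 * t) / 2 * x ^ 2) t := fun t => by
      have h := (hasDerivAt_frSq r (x ^ 2 * t)).comp t ((hasDerivAt_id t).const_mul (x ^ 2))
      simpa [Function.comp_def] using h
    have hbd : ∀ t ∈ Set.Icc (a ^ 2) (b ^ 2),
        ‖-frSq (r + 1) (x ^ 2 * t) / 2 * x ^ 2‖ ≤ x ^ 2 * B / (1 + a) ^ (r + 1) := by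
      intro t ht
      have ht0 : 0 ≤ t := (sq_nonneg a).trans ht.1
      have hs := hB (Real.sqrt t) (Real.sqrt_nonneg t)
      rw [fr_eq_frSq, mul_pow, Real.sq_sqrt ht0] at hs
      have has : a ≤ Real.sqrt t := Real.le_sqrt_of_sq_le ht.1
      have h2 : B / (1 + Real.sqrt t) ^ (r + 1) ≤ B / (1 + a) ^ (r + 1) := by gcongr
      rw [Real.norm_eq_abs, abs_mul, abs_div, abs_neg, abs_two, abs_of_nonneg (sq_nonneg x)]
      calc |frSq (r + 1) (x ^ 2 * t)| / 2 * x ^ 2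
          ≤ |frSq (r + 1) (x ^ 2 * t)| * x ^ 2 := by
            gcongr
            exact half_le_self (abs_nonneg _)
        _ ≤ B / (1 + a) ^ (r + 1) * x ^ 2 := by
            gcongr
            exact hs.trans h2
        _ = _ := by ring
    have hle : a ^ 2 ≤ b ^ 2 := by gcongr
    have hmv := (convex_Icc (a ^ 2) (b ^ 2)).norm_image_sub_le_of_norm_hasDerivWithin_le
      (fun t _ => (hd t).hasDerivWithinAt) hbd (Set.left_mem_Icc.2 hle) (Set.right_mem_Icc.2 hle)
    simp only [Real.norm_eq_abs] at hmv
    rw [abs_of_nonneg (sub_nonneg.2 hle), ← mul_pow, ← mul_pow, ← fr_eq_frSq, ← fr_eq_frSq] at hmv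
    refine hmv.trans ?_
    rw [div_mul_eq_mul_div]
    have : 0 ≤ b ^ 2 - a ^ 2 := sub_nonneg.2 hle
    gcongr
    linarith

/-- Pointwise majorant of the test integrand, for any value `d` of `|f_r(xb) - f_r(xa)|`
satisfying the decay and Lipschitz bounds. -/
theorem test_integrand_le {r j : ℕ} (hr : 1 ≤ r) (hj : r + 2 ≤ j) {C d a b : ℝ} (hC : 0 ≤ C)
    (hd : 0 ≤ d) (ha : 0 < a) (hab : a < b) (h1 : d ≤ C / (1 + a) ^ r)
    (h2 : d ≤ C * (b ^ 2 - a ^ 2) / (1 + a) ^ (r + 1)) :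
    d ^ (j + 2) / (b ^ 2 - a ^ 2) ^ j * (b * a) ^ (1 + 2 * r)
      ≤ 2 * C ^ (j + 2) * ((1 + a ^ 2)⁻¹ * (1 + (b - a) ^ 2)⁻¹) := by
  have hb : 0 < b := ha.trans hab
  have hD : 0 < b ^ 2 - a ^ 2 := by nlinarith
  have h1a : 1 ≤ 1 + a := by linarith
  have hasq : ((1 + a) ^ 2)⁻¹ ≤ (1 + a ^ 2)⁻¹ := by
    gcongr
    nlinarith
  rcases le_total (b - a) 1 with hu | hu
  · have hexp : 2 * (1 + 2 * r) + 2 ≤ (r + 1) * j + r * 2 := by nlinarith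
    have hu2 : 1 ≤ 2 * (1 + (b - a) ^ 2)⁻¹ := by
      rw [← div_eq_mul_inv, le_div_iff₀ (by positivity)]
      nlinarith
    calc d ^ (j + 2) / (b ^ 2 - a ^ 2) ^ j * (b * a) ^ (1 + 2 * r)
        = (d ^ j * d ^ 2) / (b ^ 2 - a ^ 2) ^ j * (b * a) ^ (1 + 2 * r) := by rw [pow_add]
      _ ≤ ((C * (b ^ 2 - a ^ 2) / (1 + a) ^ (r + 1)) ^ j * (C / (1 + a) ^ r) ^ 2)
            / (b ^ 2 - a ^ 2) ^ j * ((1 + a) * (1 + a)) ^ (1 + 2 * r) := by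
          gcongr <;> linarith
      _ = C ^ (j + 2) * (1 + a) ^ (2 * (1 + 2 * r)) / (1 + a) ^ ((r + 1) * j + r * 2) := by
          rw [div_pow, div_pow, mul_pow C, ← pow_two, ← pow_mul, ← pow_mul, ← pow_mul,
            pow_add (1 + a) ((r + 1) * j), pow_add C]
          field_simp
      _ ≤ C ^ (j + 2) * ((1 + a) ^ 2)⁻¹ := by
          rw [mul_div_assoc]
          gcongr
          rw [div_le_iff₀ (by positivity), inv_mul_eq_div, le_div_iff₀ (by positivity), ← pow_add]
          exact pow_le_pow_right₀ h1a hexp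
      _ ≤ C ^ (j + 2) * ((1 + a ^ 2)⁻¹ * (2 * (1 + (b - a) ^ 2)⁻¹)) := by
          gcongr
          calc ((1 + a) ^ 2)⁻¹ ≤ (1 + a ^ 2)⁻¹ * 1 := by rwa [mul_one]
            _ ≤ _ := by gcongr
      _ = _ := by ring
  · obtain ⟨m, hm⟩ : ∃ m, m = 1 + 2 * r - j := ⟨_, rfl⟩
    have hm1 : m + 2 ≤ j := by omega
    have hm2 : m + (1 + 2 * r) + 2 ≤ r * (j + 2) := by
      rcases le_total j (1 + 2 * r) with h | h
      · have : m + j = 1 + 2 * r := by omega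
        nlinarith
      · have : m = 0 := by omega
        subst this
        nlinarith
    have hb1 : 1 ≤ b := by linarith
    have hbm : b ^ (1 + 2 * r) ≤ b ^ m * b ^ j := by
      rw [← pow_add]
      exact pow_le_pow_right₀ hb1 (by omega)
    have hbu : b ≤ (1 + a) * (b - a) := by nlinarith
    have hu0 : 0 < b - a := by linarith
    have hu2 : ((b - a) ^ 2)⁻¹ ≤ 2 * (1 + (b - a) ^ 2)⁻¹ := by
      rw [← div_eq_mul_inv, inv_eq_one_div, div_le_div_iff₀ (by positivity) (by positivity)]
      nlinarith
    calc d ^ (j + 2) / (b ^ 2 - a ^ 2) ^ j * (b * a) ^ (1 + 2 * r)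
        ≤ (C / (1 + a) ^ r) ^ (j + 2) / ((b - a) * b) ^ j * ((b ^ m * b ^ j) *
            (1 + a) ^ (1 + 2 * r)) := by
          rw [mul_pow b a]
          gcongr
          · nlinarith
          · linarith
      _ = C ^ (j + 2) / (1 + a) ^ (r * (j + 2)) / (b - a) ^ j * (b ^ m *
            (1 + a) ^ (1 + 2 * r)) := by
          rw [div_pow, ← pow_mul, mul_pow (b - a)]
          field_simp
      _ ≤ C ^ (j + 2) / (1 + a) ^ (r * (j + 2)) / (b - a) ^ j * (((1 + a) * (b - a)) ^ m *
            (1 + a) ^ (1 + 2 * r)) := by gcongr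
      _ = C ^ (j + 2) * ((1 + a) ^ (m + (1 + 2 * r)) / (1 + a) ^ (r * (j + 2)) *
            ((b - a) ^ m / (b - a) ^ j)) := by
          rw [mul_pow (1 + a), pow_add _ m]
          ring
      _ ≤ C ^ (j + 2) * (((1 + a) ^ 2)⁻¹ * ((b - a) ^ 2)⁻¹) := by
          gcongr
          · rw [div_le_iff₀ (by positivity), inv_mul_eq_div, le_div_iff₀ (by positivity),
              ← pow_add]
            exact pow_le_pow_right₀ h1a hm2
          · rw [div_le_iff₀ (by positivity), inv_mul_eq_div, le_div_iff₀ (by positivity),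
              ← pow_add]
            exact pow_le_pow_right₀ hu hm1
      _ ≤ C ^ (j + 2) * ((1 + a ^ 2)⁻¹ * (2 * (1 + (b - a) ^ 2)⁻¹)) := by gcongr
      _ = _ := by ring

theorem lintegral_sheared_inv_one_add_sq_lt_top {K : ℝ} (hK : 0 ≤ K) :
    ∫⁻ p : ℝ × ℝ, ENNReal.ofReal (K * ((1 + p.2 ^ 2)⁻¹ * (1 + (p.1 - p.2) ^ 2)⁻¹)) < ⊤ := by
  have hI : ∫⁻ u : ℝ, ENNReal.ofReal ((1 + u ^ 2)⁻¹) < ⊤ :=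
    integrable_inv_one_add_sq.lintegral_lt_top
  have hmeas : Measurable fun p : ℝ × ℝ =>
      ENNReal.ofReal (K * ((1 + p.2 ^ 2)⁻¹ * (1 + (p.1 - p.2) ^ 2)⁻¹)) := by fun_prop
  rw [Measure.volume_eq_prod, lintegral_prod_symm _ hmeas.aemeasurable]
  have hinner : ∀ a : ℝ,
      ∫⁻ b : ℝ, ENNReal.ofReal (K * ((1 + a ^ 2)⁻¹ * (1 + (b - a) ^ 2)⁻¹)) =
        ENNReal.ofReal K * ENNReal.ofReal ((1 + a ^ 2)⁻¹) *
          ∫⁻ u : ℝ, ENNReal.ofReal ((1 + u ^ 2)⁻¹) := by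
    intro a
    rw [← lintegral_sub_right_eq_self (fun u : ℝ => ENNReal.ofReal ((1 + u ^ 2)⁻¹)) a,
      ← lintegral_const_mul _ (by fun_prop)]
    refine lintegral_congr fun b => ?_
    rw [ENNReal.ofReal_mul hK, ENNReal.ofReal_mul (by positivity), mul_assoc]
  simp only [hinner]
  rw [lintegral_mul_const _ (by fun_prop), lintegral_const_mul _ (by fun_prop)]
  exact ENNReal.mul_lt_top (ENNReal.mul_lt_top ENNReal.ofReal_lt_top hI) hI

theorem fr_zero_pos (r : ℕ) : 0 < fr r 0 := by
  rw [fr, tsum_eq_single 0 fun l hl => by simp [hl]]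
  simp only [mul_zero, pow_zero, zero_add, mul_one, Nat.factorial_zero, Nat.cast_one, add_zero]
  positivity

/-- The increment `|f_r(xb) - f_r(xa)|` is bounded below for `a` near `0` and `b` near infinity. -/
theorem exists_le_abs_fr_sub {r : ℕ} (hr : 1 ≤ r) {x : ℝ} (hx : 0 < x) :
    ∃ c δ M : ℝ, 0 < c ∧ 0 < δ ∧ δ ≤ 1 ∧ 1 ≤ M ∧ ∀ a b : ℝ, 0 < a → a < δ → M < b →
      c ≤ |fr r (x * b) - fr r (x * a)| := by
  set q := fr r 0 with hq
  have hq0 : 0 < q := fr_zero_pos r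
  obtain ⟨C, hC0, hC⟩ := exists_abs_fr_mul_le r hx
  have hcont : ContinuousAt (fun s => fr r (x * s)) 0 :=
    ((continuous_fr r).comp (continuous_const.mul continuous_id)).continuousAt
  obtain ⟨δ, hδ, hδ'⟩ := Metric.continuousAt_iff.1 hcont (q / 3) (by positivity)
  refine ⟨q / 3, min δ 1, max 1 (3 * C / q), by positivity, lt_min hδ one_pos, min_le_right _ _,
    le_max_left _ _, fun a b ha haδ hb => ?_⟩
  have h1 := hδ' (x := a) (by
    rw [Real.dist_eq, sub_zero, abs_of_pos ha]
    exact haδ.trans_le (min_le_left _ _))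
  rw [Real.dist_eq, mul_zero, ← hq, abs_lt] at h1
  have hb1 : 1 < b := (le_max_left _ _).trans_lt hb
  have hb2 : 3 * C / q < b := (le_max_right _ _).trans_lt hb
  have h2 : |fr r (x * b)| ≤ q / 3 := by
    refine (hC b (by linarith)).trans ?_
    have hpow : 1 + b ≤ (1 + b) ^ r := le_self_pow₀ (by linarith) (by omega)
    rw [div_le_iff₀ (by positivity)]
    rw [div_lt_iff₀ hq0] at hb2
    nlinarith
  rw [abs_le] at h2
  rw [abs_sub_comm]
  exact le_trans (by linarith) (le_abs_self _)

theorem lintegral_strip_inv_eq_top {K δ M : ℝ} (hK : 0 < K) (hδ : 0 < δ) (hM : 1 ≤ M) :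
    ∫⁻ p in Set.Ioi M ×ˢ Set.Ioo (δ / 2) δ, ENNReal.ofReal (K * p.1⁻¹) = (⊤ : ENNReal) := by
  have hinv : ∫⁻ b in Set.Ioi M, ENNReal.ofReal (b⁻¹) = ⊤ := by
    by_contra h
    refine not_integrableOn_Ioi_inv (a := M) ⟨by fun_prop, ?_⟩
    rw [hasFiniteIntegral_iff_ofReal]
    · exact lt_top_iff_ne_top.2 h
    · filter_upwards [ae_restrict_mem measurableSet_Ioi] with b hb
      exact inv_nonneg.2 (zero_le_one.trans (hM.trans (le_of_lt hb)))
  rw [Measure.volume_eq_prod, ← Measure.prod_restrict, lintegral_prod _ (by fun_prop)]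
  simp only [lintegral_const, ENNReal.ofReal_mul hK.le]
  rw [lintegral_mul_const _ (by fun_prop), lintegral_const_mul _ (by fun_prop), hinv,
    ENNReal.mul_top (by simpa using hK), ENNReal.top_mul]
  rw [Measure.restrict_apply_univ, Real.volume_Ioo]
  simp only [ne_eq, ENNReal.ofReal_eq_zero, not_le]
  linarith

/-- Type A singular point: for `r ≥ 1`, `x > 0` and integer `k ≥ 2`, the Plancherel test
integral over the Weyl chamber `{λ₁ > λ₂ > 0}` is finite if and only if `k ≥ 7/4 + r/2`. -/
theorem stmt_13 (r : ℕ) (hr : 1 ≤ r) (x : ℝ) (hx : 0 < x) (k : ℕ) (hk : 2 ≤ k) :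
    (∫⁻ p in {p : ℝ × ℝ | 0 < p.2 ∧ p.2 < p.1},
        ENNReal.ofReal
          (|fr r (x * p.1) - fr r (x * p.2)| ^ (2 * k)
            / (p.1 ^ 2 - p.2 ^ 2) ^ (2 * k - 2) * (p.1 * p.2) ^ (1 + 2 * r)) < ⊤)
      ↔ (7 / 4 + (r : ℝ) / 2 ≤ (k : ℝ)) := by
  have hW : MeasurableSet {p : ℝ × ℝ | 0 < p.2 ∧ p.2 < p.1} :=
    (measurableSet_lt measurable_const measurable_snd).inter
      (measurableSet_lt measurable_snd measurable_fst)
  obtain ⟨j, hj⟩ : ∃ j, j = 2 * k - 2 := ⟨_, rfl⟩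
  have hkj : 2 * k = j + 2 := by omega
  rw [← hj, hkj]
  constructor
  · intro hfin
    by_contra hlt
    have hjr : j ≤ r + 1 := by
      have h4 : 4 * (k : ℝ) < 7 + 2 * r := by linarith
      have : 4 * k < 7 + 2 * r := by exact_mod_cast h4
      omega
    obtain ⟨c, δ, M, hc, hδ, hδ1, hM, hlow⟩ := exists_le_abs_fr_sub hr hx
    refine hfin.ne (top_le_iff.1 ?_)
    rw [← lintegral_strip_inv_eq_top (K := c ^ (j + 2) * (δ / 2) ^ (1 + 2 * r))
      (by positivity) hδ hM]
    have hsub : Set.Ioi M ×ˢ Set.Ioo (δ / 2) δ ⊆ {p : ℝ × ℝ | 0 < p.2 ∧ p.2 < p.1} := by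
      rintro ⟨b, a⟩ ⟨hb, ha1, ha2⟩
      simp only [Set.mem_Ioi, Set.mem_ofPred_eq] at hb ha1 ha2 ⊢
      constructor <;> linarith
    refine le_trans (setLIntegral_mono' (measurableSet_Ioi.prod measurableSet_Ioo) ?_)
      (lintegral_mono_set hsub)
    rintro ⟨b, a⟩ ⟨hb, ha1, ha2⟩
    simp only [Set.mem_Ioi] at hb ha1 ha2
    refine ENNReal.ofReal_le_ofReal ?_
    have ha : 0 < a := by linarith
    have hb1 : 1 < b := by linarith
    have hD : 0 < b ^ 2 - a ^ 2 := by nlinarith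
    have hpow : b⁻¹ ≤ b ^ (1 + 2 * r) / (b ^ 2) ^ j := by
      rw [inv_eq_one_div, div_le_div_iff₀ (by positivity) (by positivity), one_mul, ← pow_mul,
        ← pow_succ]
      exact pow_le_pow_right₀ hb1.le (by omega)
    calc c ^ (j + 2) * (δ / 2) ^ (1 + 2 * r) * b⁻¹
        ≤ c ^ (j + 2) * a ^ (1 + 2 * r) * (b ^ (1 + 2 * r) / (b ^ 2) ^ j) := by gcongr
      _ = c ^ (j + 2) / (b ^ 2) ^ j * (b * a) ^ (1 + 2 * r) := by rw [mul_pow]; ring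
      _ ≤ _ := by
          gcongr
          · exact hlow a b ha ha2 hb
          · nlinarith
  · intro hle
    have hjr : r + 2 ≤ j := by
      have h4 : 7 + 2 * (r : ℝ) ≤ 4 * k := by linarith
      have : 7 + 2 * r ≤ 4 * k := by exact_mod_cast h4
      omega
    obtain ⟨C, hC0, hC⟩ := exists_abs_fr_sub_le r hx
    refine lt_of_le_of_lt ?_ (lintegral_sheared_inv_one_add_sq_lt_top
      (K := 2 * C ^ (j + 2)) (by positivity))
    refine le_trans (setLIntegral_mono' hW ?_) (setLIntegral_le_lintegral _ _)
    rintro ⟨b, a⟩ ⟨ha, hab⟩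
    obtain ⟨h1, h2⟩ := hC a b (le_of_lt ha) hab
    exact ENNReal.ofReal_le_ofReal (test_integrand_le hr hjr hC0 (abs_nonneg _) ha hab h1 h2)
end
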